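/- For every α ∈ (0, 3/2 + √2], the map t ↦ N_α^{1/2}(X_t) = exp(h_α(p(·,t))) is concave on (0, t_α); equivalently, ∂²/∂t² exp(h_α(p(·,t))) ≤ 0 for all t ∈ (0, t_α). -/

import Mathlib

open MeasureTheory Real Filter
open scoped Classical

/-- The density `p(x,t)` of `X + √t Z` along the heat flow. -/
noncomputable def heatP (f : ℝ → ℝ) (t x : ℝ) : ℝ :=
  ∫ y : ℝ, f y * ((Real.sqrt (2 * Real.pi * t))⁻¹ * Real.exp (-(x - y) ^ 2 / (2 * t)))

/-- `p_k(x,t) = ∂^k p / ∂x^k`. -/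
noncomputable def pk (f : ℝ → ℝ) (k : ℕ) (t x : ℝ) : ℝ :=
  iteratedDeriv k (heatP f t) x

/-- `p̄_i = p_i / p`. -/
noncomputable def pbar (f : ℝ → ℝ) (i : ℕ) (t x : ℝ) : ℝ :=
  pk f i t x / heatP f t x

/-- The Rényi entropy `h_α(p(·,t))`, with the Shannon entropy at `α = 1`. -/
noncomputable def renyiEnt (f : ℝ → ℝ) (α t : ℝ) : ℝ :=
  if α = 1 then -∫ x : ℝ, heatP f t x * Real.log (heatP f t x)
  else (1 - α)⁻¹ * Real.log (∫ x : ℝ, heatP f t x ^ α)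

/-- Finiteness `|h_α(p(·,t))| < ∞` of the Rényi entropy at time `t`. -/
def renyiFinite (f : ℝ → ℝ) (α t : ℝ) : Prop :=
  if α = 1 then Integrable (fun x : ℝ => heatP f t x * Real.log (heatP f t x))
  else Integrable (fun x : ℝ => heatP f t x ^ α) ∧ 0 < ∫ x : ℝ, heatP f t x ^ α

/-- `t < t_α` where `t_α = sup { s > 0 : |h_α(p(·,s))| < ∞ }`. -/
def ltTalpha (f : ℝ → ℝ) (α t : ℝ) : Prop :=
  ∃ s : ℝ, t < s ∧ 0 < s ∧ renyiFinite f α s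

/-- The tilted expectation `E_α[g] = (∫ g p^α) / (∫ p^α)`. -/
noncomputable def Ea (f : ℝ → ℝ) (α t : ℝ) (g : ℝ → ℝ) : ℝ :=
  (∫ x : ℝ, g x * heatP f t x ^ α) / (∫ x : ℝ, heatP f t x ^ α)

/-! ### The Gaussian kernel and its moments -/

/-- The Gaussian kernel. -/
noncomputable def gK (t z : ℝ) : ℝ := (Real.sqrt (2 * Real.pi * t))⁻¹ * Real.exp (-z ^ 2 / (2 * t))

lemma gK_pos {t : ℝ} (ht : 0 < t) (z : ℝ) : 0 < gK t z := by
  unfold gK; positivity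

lemma gK_cont (t : ℝ) : Continuous (gK t) := by
  unfold gK; fun_prop

lemma gK_dx {t : ℝ} (ht : 0 < t) (z : ℝ) : HasDerivAt (gK t) (-(z / t) * gK t z) z := by
  unfold gK
  have h1 : HasDerivAt (fun z : ℝ => -z ^ 2 / (2 * t)) (-(z / t)) z := by
    have := ((hasDerivAt_pow 2 z).fun_neg.div_const (2 * t))
    refine this.congr_deriv ?_
    push_cast
    field_simp
    try norm_num
  have := (h1.exp).const_mul (Real.sqrt (2 * Real.pi * t))⁻¹
  refine this.congr_deriv ?_
  ring

lemma gK_dt {t : ℝ} (ht : 0 < t) (z : ℝ) :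
    HasDerivAt (fun t => gK t z) ((-1 / (2 * t) + z ^ 2 / (2 * t ^ 2)) * gK t z) t := by
  unfold gK
  have hpt : 0 < 2 * Real.pi * t := by positivity
  have h1 : HasDerivAt (fun t : ℝ => -z ^ 2 / (2 * t)) (z ^ 2 / (2 * t ^ 2)) t := by
    have := ((hasDerivAt_id t).const_mul 2).fun_inv (by simpa using ht.ne')
    have := this.const_mul (-z ^ 2)
    refine (this.congr_deriv ?_).congr_of_eventuallyEq ?_
    · simp only [id]; field_simp
    · exact Eventually.of_forall fun u => by simp [div_eq_mul_inv]
  have h2 : HasDerivAt (fun t : ℝ => (Real.sqrt (2 * Real.pi * t))⁻¹)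
      (-1 / (2 * t) * (Real.sqrt (2 * Real.pi * t))⁻¹) t := by
    have h3 := ((hasDerivAt_id t).const_mul (2 * Real.pi))
    have h4 := (h3.sqrt hpt.ne').fun_inv (by simpa using (Real.sqrt_pos.2 hpt).ne')
    refine h4.congr_deriv ?_
    simp only [id]
    have h5 : Real.sqrt (2 * Real.pi * t) ^ 2 = 2 * Real.pi * t := Real.sq_sqrt hpt.le
    rw [h5]
    have : Real.sqrt (2 * Real.pi * t) ≠ 0 := (Real.sqrt_pos.2 hpt).ne'
    field_simp
  have := h2.mul h1.exp
  refine this.congr_deriv ?_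
  ring

lemma gK_bound {t₁ t₂ s : ℝ} (h1 : 0 < t₁) (h2 : t₁ < t₂) (h3 : t₂ < s) (j : ℕ) :
    ∃ C : ℝ, 0 < C ∧ ∀ t, t₁ ≤ t → t ≤ t₂ → ∀ z, (1 + z ^ 2) ^ j * gK t z ≤ C * gK s z := by
  have h2' : 0 < t₂ := h1.trans h2
  have hs : 0 < s := h2'.trans h3
  set c := 1 / (2 * t₂) - 1 / (2 * s) with hc
  have hcpos : 0 < c := by
    rw [hc, sub_pos]
    apply one_div_lt_one_div_of_lt <;> linarith
  have hS : 0 < Real.sqrt (2 * Real.pi * s) := Real.sqrt_pos.2 (by positivity)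
  refine ⟨(Real.sqrt (2 * Real.pi * t₁))⁻¹ * ((j.factorial : ℝ) / c ^ j) * Real.exp c *
    Real.sqrt (2 * Real.pi * s), by positivity, ?_⟩
  intro t ht1 ht2 z
  have htp : 0 < t := h1.trans_le ht1
  have e1 : (1 + z ^ 2) ^ j ≤ (j.factorial : ℝ) / c ^ j * Real.exp (c * (1 + z ^ 2)) := by
    have := Real.pow_div_factorial_le_exp (x := c * (1 + z ^ 2)) (by positivity) j
    rw [mul_pow, div_le_iff₀ (by positivity)] at this
    rw [div_mul_eq_mul_div, le_div_iff₀ (by positivity)]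
    linarith
  have e2 : gK t z ≤ (Real.sqrt (2 * Real.pi * t₁))⁻¹ * Real.exp (-z ^ 2 / (2 * t₂)) := by
    unfold gK
    have a1 : 0 < Real.sqrt (2 * Real.pi * t₁) := Real.sqrt_pos.2 (by positivity)
    have a2 : Real.sqrt (2 * Real.pi * t₁) ≤ Real.sqrt (2 * Real.pi * t) :=
      Real.sqrt_le_sqrt (by gcongr)
    have a3 : -z ^ 2 / (2 * t) ≤ -z ^ 2 / (2 * t₂) := by
      rw [neg_div, neg_div, neg_le_neg_iff]
      gcongr
    gcongr
  have e3 : Real.exp (c * (1 + z ^ 2)) * Real.exp (-z ^ 2 / (2 * t₂))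
      = Real.exp c * Real.exp (-z ^ 2 / (2 * s)) := by
    rw [← Real.exp_add, ← Real.exp_add]
    congr 1
    rw [hc]; ring
  calc (1 + z ^ 2) ^ j * gK t z ≤ ((j.factorial : ℝ) / c ^ j * Real.exp (c * (1 + z ^ 2))) *
        ((Real.sqrt (2 * Real.pi * t₁))⁻¹ * Real.exp (-z ^ 2 / (2 * t₂))) :=
        mul_le_mul e1 e2 (gK_pos htp z).le (by positivity)
    _ = (Real.sqrt (2 * Real.pi * t₁))⁻¹ * ((j.factorial : ℝ) / c ^ j) *
        (Real.exp (c * (1 + z ^ 2)) * Real.exp (-z ^ 2 / (2 * t₂))) := by ring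
    _ = _ := by
        rw [e3]; unfold gK
        field_simp

lemma gK_le {t : ℝ} (ht : 0 < t) (z : ℝ) : gK t z ≤ (Real.sqrt (2 * Real.pi * t))⁻¹ := by
  unfold gK
  have : Real.exp (-z ^ 2 / (2 * t)) ≤ 1 := by
    rw [Real.exp_le_one_iff, neg_div]
    have : 0 ≤ z ^ 2 / (2 * t) := by positivity
    linarith
  exact mul_le_of_le_one_right (by positivity) this

/-- uniform bound -/
lemma gK_bound' {t₁ t₂ : ℝ} (h1 : 0 < t₁) (h2 : t₁ < t₂) (j : ℕ) :
    ∃ C : ℝ, 0 < C ∧ ∀ t, t₁ ≤ t → t ≤ t₂ → ∀ z, (1 + z ^ 2) ^ j * gK t z ≤ C := by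
  obtain ⟨C, hC, h⟩ := gK_bound h1 h2 (show t₂ < t₂ + 1 by linarith) j
  have hs : 0 < t₂ + 1 := by linarith
  refine ⟨C * (Real.sqrt (2 * Real.pi * (t₂ + 1)))⁻¹, by positivity, fun t a b z => ?_⟩
  exact (h t a b z).trans (mul_le_mul_of_nonneg_left (gK_le hs z) hC.le)

lemma abs_pow_le_w (z : ℝ) (k : ℕ) : |z ^ k| ≤ (1 + z ^ 2) ^ k := by
  rw [abs_pow]
  have : |z| ≤ 1 + z ^ 2 := by
    rw [← sq_abs z]; nlinarith [sq_nonneg (|z| - 1), abs_nonneg z]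
  gcongr

lemma w_mono (z : ℝ) {j k : ℕ} (h : j ≤ k) : (1 + z ^ 2) ^ j ≤ (1 + z ^ 2) ^ k :=
  pow_le_pow_right₀ (by nlinarith [sq_nonneg z]) h

/-- moments -/
noncomputable def mom (f : ℝ → ℝ) (k : ℕ) (t x : ℝ) : ℝ :=
  ∫ y : ℝ, f y * ((x - y) ^ k * gK t (x - y))

/-- weights -/
noncomputable def wt (f : ℝ → ℝ) (k : ℕ) (t x : ℝ) : ℝ :=
  ∫ y : ℝ, f y * ((1 + (x - y) ^ 2) ^ k * gK t (x - y))

lemma mom_zero (f : ℝ → ℝ) (t x : ℝ) : mom f 0 t x = heatP f t x := by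
  simp [mom, heatP, gK]

lemma wt_zero (f : ℝ → ℝ) (t x : ℝ) : wt f 0 t x = heatP f t x := by
  simp [wt, heatP, gK]

lemma mom_integrable {f : ℝ → ℝ} (hfi : Integrable f) (k : ℕ) {t : ℝ} (ht : 0 < t) (x : ℝ) :
    Integrable (fun y : ℝ => f y * ((x - y) ^ k * gK t (x - y))) := by
  obtain ⟨C, hC, h⟩ := gK_bound' (half_pos ht) (show t / 2 < t by linarith) k
  refine hfi.mul_bdd (c := C) ?_ (Eventually.of_forall fun y => ?_)
  · have := gK_cont t
    exact Continuous.aestronglyMeasurable (by fun_prop)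
  · rw [Real.norm_eq_abs, abs_mul, abs_of_pos (gK_pos ht _)]
    exact (mul_le_mul_of_nonneg_right (abs_pow_le_w _ _) (gK_pos ht _).le).trans
      (h t (by linarith) le_rfl _)

lemma wt_integrable {f : ℝ → ℝ} (hfi : Integrable f) (k : ℕ) {t : ℝ} (ht : 0 < t) (x : ℝ) :
    Integrable (fun y : ℝ => f y * ((1 + (x - y) ^ 2) ^ k * gK t (x - y))) := by
  obtain ⟨C, hC, h⟩ := gK_bound' (half_pos ht) (show t / 2 < t by linarith) k
  refine hfi.mul_bdd (c := C) ?_ (Eventually.of_forall fun y => ?_)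
  · have := gK_cont t
    exact Continuous.aestronglyMeasurable (by fun_prop)
  · rw [Real.norm_eq_abs, abs_of_nonneg (mul_nonneg (by positivity) (gK_pos ht _).le)]
    exact (h t (by linarith) le_rfl _)

lemma mom_dx {f : ℝ → ℝ} (hfi : Integrable f) (k : ℕ) {t : ℝ} (ht : 0 < t) (x : ℝ) :
    HasDerivAt (mom f k t) (k * mom f (k - 1) t x - mom f (k + 1) t x / t) x := by
  obtain ⟨C, hC, h⟩ := gK_bound' (half_pos ht) (show t / 2 < t by linarith) (k + 1)
  have hc := gK_cont t
  have key := hasDerivAt_integral_of_dominated_loc_of_deriv_le (μ := volume) (s := Set.univ)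
    (F := fun x y => f y * ((x - y) ^ k * gK t (x - y)))
    (F' := fun x y => f y * (k * ((x - y) ^ (k - 1) * gK t (x - y))
      - ((x - y) ^ (k + 1) * gK t (x - y)) / t)) (x₀ := x)
    (bound := fun y => ‖f y‖ * (k * C + C / t)) univ_mem
    (Eventually.of_forall fun x => (mom_integrable hfi k ht x).aestronglyMeasurable)
    (mom_integrable hfi k ht x)
    (hfi.aestronglyMeasurable.mul (Continuous.aestronglyMeasurable (by fun_prop)))
    (Eventually.of_forall fun y x _ => ?_) (hfi.norm.mul_const _)
    (Eventually.of_forall fun y x _ => ?_)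
  · have h2 := key.2
    refine h2.congr_deriv ?_
    have i1 := mom_integrable hfi (k - 1) ht x
    have i2 := mom_integrable hfi (k + 1) ht x
    unfold mom
    rw [← integral_const_mul, ← integral_div, ← integral_sub (i1.const_mul _) (i2.div_const _)]
    congr 1
    ext y; ring
  · rw [norm_mul]
    gcongr
    refine (norm_sub_le _ _).trans ?_
    have g0 := (gK_pos ht (x - y)).le
    have b1 : ∀ j ≤ k + 1, ‖(x - y) ^ j * gK t (x - y)‖ ≤ C := by
      intro j hj
      rw [Real.norm_eq_abs, abs_mul, abs_of_nonneg g0]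
      refine le_trans ?_ (h t (by linarith) le_rfl (x - y))
      exact mul_le_mul_of_nonneg_right ((abs_pow_le_w _ _).trans (w_mono _ hj)) g0
    rw [norm_mul, norm_div, Real.norm_natCast, Real.norm_of_nonneg ht.le]
    gcongr
    · exact b1 _ (by omega)
    · exact b1 _ le_rfl
  · have d1 := (hasDerivAt_id x).sub_const y
    have d2 := d1.fun_pow k
    have d3 : HasDerivAt (fun x => gK t (x - y)) (-((x - y) / t) * gK t (x - y)) x := by
      have := (gK_dx ht (x - y)).comp x d1
      simpa [Function.comp_def] using this
    have d4 := (d2.mul d3).const_mul (f y)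
    refine d4.congr_deriv ?_
    simp only [id]
    ring

lemma mom_dt {f : ℝ → ℝ} (hfi : Integrable f) (k : ℕ) {t : ℝ} (ht : 0 < t) (x : ℝ) :
    HasDerivAt (fun t => mom f k t x)
      (-mom f k t x / (2 * t) + mom f (k + 2) t x / (2 * t ^ 2)) t := by
  obtain ⟨C, hC, h⟩ := gK_bound' (half_pos ht) (show t / 2 < 2 * t by linarith) (k + 2)
  have hc := gK_cont t
  have key := hasDerivAt_integral_of_dominated_loc_of_deriv_le (μ := volume)
    (s := Set.Ioo (t / 2) (2 * t))
    (F := fun t y => f y * ((x - y) ^ k * gK t (x - y)))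
    (F' := fun t y => f y * (-((x - y) ^ k * gK t (x - y)) / (2 * t)
      + ((x - y) ^ (k + 2) * gK t (x - y)) / (2 * t ^ 2))) (x₀ := t)
    (bound := fun y => ‖f y‖ * (C / (2 * (t / 2)) + C / (2 * (t / 2) ^ 2)))
    (Ioo_mem_nhds (by linarith) (by linarith))
    (Filter.mem_of_superset (lt_mem_nhds ht)
      fun u hu => (mom_integrable hfi k hu x).aestronglyMeasurable)
    (mom_integrable hfi k ht x)
    (hfi.aestronglyMeasurable.mul (Continuous.aestronglyMeasurable (by fun_prop)))
    (Eventually.of_forall fun y u hu => ?_) (hfi.norm.mul_const _)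
    (Eventually.of_forall fun y u hu => ?_)
  · have h2 := key.2
    refine h2.congr_deriv ?_
    have i1 := mom_integrable hfi k ht x
    have i2 := mom_integrable hfi (k + 2) ht x
    unfold mom
    rw [← integral_neg, ← integral_div, ← integral_div,
      ← integral_add (i1.fun_neg.div_const _) (i2.div_const _)]
    congr 1
    ext y; ring
  · have hu0 : 0 < u := by have := hu.1; linarith
    rw [norm_mul]
    gcongr
    refine (norm_add_le _ _).trans ?_
    have g0 := (gK_pos hu0 (x - y)).le
    have b1 : ∀ j ≤ k + 2, ‖(x - y) ^ j * gK u (x - y)‖ ≤ C := by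
      intro j hj
      rw [Real.norm_eq_abs, abs_mul, abs_of_nonneg g0]
      refine le_trans ?_ (h u hu.1.le hu.2.le (x - y))
      exact mul_le_mul_of_nonneg_right ((abs_pow_le_w _ _).trans (w_mono _ hj)) g0
    have l1 := hu.1.le
    rw [norm_div, norm_div, norm_neg, Real.norm_of_nonneg (show 0 ≤ 2 * u by positivity),
      Real.norm_of_nonneg (show 0 ≤ 2 * u ^ 2 by positivity)]
    gcongr
    · exact b1 _ (by omega)
    · exact b1 _ le_rfl
  · have hu0 : 0 < u := by have := hu.1; linarith
    have d3 := ((gK_dt hu0 (x - y)).const_mul ((x - y) ^ k)).const_mul (f y)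
    refine d3.congr_deriv ?_
    field_simp
    ring

/-- heat kernel derivatives divided by `p` -/
noncomputable def q1 (f : ℝ → ℝ) (t x : ℝ) : ℝ := (-mom f 1 t x / t) / mom f 0 t x
noncomputable def q2 (f : ℝ → ℝ) (t x : ℝ) : ℝ :=
  (mom f 2 t x / t ^ 2 - mom f 0 t x / t) / mom f 0 t x
noncomputable def q3 (f : ℝ → ℝ) (t x : ℝ) : ℝ :=
  (-mom f 3 t x / t ^ 3 + 3 * mom f 1 t x / t ^ 2) / mom f 0 t x
noncomputable def q4 (f : ℝ → ℝ) (t x : ℝ) : ℝ :=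
  (mom f 4 t x / t ^ 4 - 6 * mom f 2 t x / t ^ 3 + 3 * mom f 0 t x / t ^ 2) / mom f 0 t x

lemma mom_pos {f : ℝ → ℝ} (hf0 : ∀ x, 0 ≤ f x) (hf1 : (∫ x : ℝ, f x) = 1)
    {t : ℝ} (ht : 0 < t) (x : ℝ) : 0 < mom f 0 t x := by
  have hfi : Integrable f := by
    by_contra h
    rw [integral_undef h] at hf1; norm_num at hf1
  unfold mom
  rw [integral_pos_iff_support_of_nonneg]
  · have e : Function.support (fun y => f y * ((x - y) ^ 0 * gK t (x - y)))
        = Function.support f := by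
      ext y
      simp [(gK_pos ht (x - y)).ne']
    rw [e, ← integral_pos_iff_support_of_nonneg hf0 hfi, hf1]
    norm_num
  · intro y
    have := (gK_pos ht (x - y)).le
    have := hf0 y
    simp only [pow_zero, one_mul, Pi.zero_apply]
    positivity
  · exact mom_integrable hfi 0 ht x

lemma p_dx {f : ℝ → ℝ} (hfi : Integrable f) {t : ℝ} (ht : 0 < t) (x : ℝ)
    (hp : 0 < mom f 0 t x) : HasDerivAt (mom f 0 t) (mom f 0 t x * q1 f t x) x := by
  refine (mom_dx hfi 0 ht x).congr_deriv ?_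
  unfold q1; field_simp; push_cast; ring

lemma p_dt {f : ℝ → ℝ} (hfi : Integrable f) {t : ℝ} (ht : 0 < t) (x : ℝ)
    (hp : 0 < mom f 0 t x) : HasDerivAt (fun t => mom f 0 t x) (mom f 0 t x * (q2 f t x / 2)) t := by
  refine (mom_dt hfi 0 ht x).congr_deriv ?_
  unfold q2; field_simp; push_cast; ring

lemma q1_dx {f : ℝ → ℝ} (hfi : Integrable f) {t : ℝ} (ht : 0 < t) (x : ℝ)
    (hp : 0 < mom f 0 t x) : HasDerivAt (q1 f t) (q2 f t x - q1 f t x ^ 2) x := by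
  refine (((mom_dx hfi 1 ht x).fun_neg.div_const t).fun_div (mom_dx hfi 0 ht x) hp.ne').congr_deriv ?_
  unfold q1 q2; field_simp; push_cast; ring

lemma q2_dx {f : ℝ → ℝ} (hfi : Integrable f) {t : ℝ} (ht : 0 < t) (x : ℝ)
    (hp : 0 < mom f 0 t x) : HasDerivAt (q2 f t) (q3 f t x - q1 f t x * q2 f t x) x := by
  refine ((((mom_dx hfi 2 ht x).div_const (t ^ 2)).fun_sub ((mom_dx hfi 0 ht x).div_const t)).fun_div
    (mom_dx hfi 0 ht x) hp.ne').congr_deriv ?_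
  unfold q1 q2 q3; field_simp; push_cast; ring

lemma q3_dx {f : ℝ → ℝ} (hfi : Integrable f) {t : ℝ} (ht : 0 < t) (x : ℝ)
    (hp : 0 < mom f 0 t x) : HasDerivAt (q3 f t) (q4 f t x - q1 f t x * q3 f t x) x := by
  refine ((((mom_dx hfi 3 ht x).fun_neg.div_const (t ^ 3)).fun_add
    (((mom_dx hfi 1 ht x).const_mul 3).div_const (t ^ 2))).fun_div
    (mom_dx hfi 0 ht x) hp.ne').congr_deriv ?_
  unfold q1 q3 q4; field_simp; push_cast; ring

lemma q2_dt {f : ℝ → ℝ} (hfi : Integrable f) {t : ℝ} (ht : 0 < t) (x : ℝ)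
    (hp : 0 < mom f 0 t x) : HasDerivAt (fun t => q2 f t x) ((q4 f t x - q2 f t x ^ 2) / 2) t := by
  have a1 := (mom_dt hfi 2 ht x).fun_div (hasDerivAt_pow 2 t) (by positivity)
  have a2 := (mom_dt hfi 0 ht x).fun_div (hasDerivAt_id t) ht.ne'
  refine ((a1.fun_sub a2).fun_div (mom_dt hfi 0 ht x) hp.ne').congr_deriv ?_
  unfold q2 q4; simp only [id]; field_simp; push_cast; ring


/-! ### Domination -/

/-- total size of the normalized derivatives -/
noncomputable def qS (f : ℝ → ℝ) (t x : ℝ) : ℝ :=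
  1 + |q1 f t x| + |q2 f t x| + |q3 f t x| + |q4 f t x|

lemma integrable_of_int_one {f : ℝ → ℝ} (hf1 : (∫ x : ℝ, f x) = 1) : Integrable f := by
  by_contra h
  rw [integral_undef h] at hf1; norm_num at hf1

lemma mom_cont {f : ℝ → ℝ} (hfi : Integrable f) (k : ℕ) {t : ℝ} (ht : 0 < t) :
    Continuous (mom f k t) :=
  continuous_iff_continuousAt.2 fun x => (mom_dx hfi k ht x).continuousAt

lemma young_aux {W lam : ℝ} (hW : 0 ≤ W) (hl : 0 < lam) {N : ℕ} (hN : N ≠ 0) :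
    W ≤ lam + lam * (lam ^ N)⁻¹ * W ^ N := by
  rcases le_total W lam with h | h
  · have : 0 ≤ lam * (lam ^ N)⁻¹ * W ^ N := by positivity
    linarith
  · have h1 : 1 ≤ W / lam := (one_le_div hl).2 h
    have h2 : W / lam ≤ (W / lam) ^ N := le_self_pow₀ h1 hN
    have h3 : lam * (W / lam) ≤ lam * (W / lam) ^ N := by gcongr
    rw [mul_div_cancel₀ _ hl.ne', div_pow] at h3
    have : lam * (W ^ N / lam ^ N) = lam * (lam ^ N)⁻¹ * W ^ N := by ring
    linarith

lemma p_mono {f : ℝ → ℝ} (hf0 : ∀ x, 0 ≤ f x) (hf1 : (∫ x : ℝ, f x) = 1)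
    {t₁ t₂ s : ℝ} (h1 : 0 < t₁) (h2 : t₁ < t₂) (h3 : t₂ < s) :
    ∃ C : ℝ, 0 < C ∧ ∀ t, t₁ ≤ t → t ≤ t₂ → ∀ x, mom f 0 t x ≤ C * mom f 0 s x := by
  obtain ⟨C, hC, h⟩ := gK_bound h1 h2 h3 0
  have hfi := integrable_of_int_one hf1
  have hs : 0 < s := by linarith
  refine ⟨C, hC, fun t a b x => ?_⟩
  unfold mom
  rw [← integral_const_mul]
  refine integral_mono (mom_integrable hfi 0 (by linarith) x)
    ((mom_integrable hfi 0 hs x).const_mul C) fun y => ?_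
  have := mul_le_mul_of_nonneg_left (h t a b (x - y)) (hf0 y)
  simp only [pow_zero, one_mul] at this ⊢
  linarith

lemma wt_le {f : ℝ → ℝ} (hf0 : ∀ x, 0 ≤ f x) (hf1 : (∫ x : ℝ, f x) = 1)
    {t₁ t₂ s : ℝ} (h1 : 0 < t₁) (h2 : t₁ < t₂) (h3 : t₂ < s) {N : ℕ} (hN : N ≠ 0) :
    ∃ C : ℝ, 0 < C ∧ ∀ t, t₁ ≤ t → t ≤ t₂ → ∀ x,
      wt f 4 t x ≤ C * (mom f 0 s x / mom f 0 t x) ^ (1 / (N : ℝ)) * mom f 0 t x := by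
  obtain ⟨C, hC, h⟩ := gK_bound h1 h2 h3 (4 * N)
  have hfi := integrable_of_int_one hf1
  have hs : 0 < s := by linarith
  refine ⟨1 + C, by positivity, fun t a b x => ?_⟩
  have ht : 0 < t := by linarith
  have pt := mom_pos hf0 hf1 ht x
  have ps := mom_pos hf0 hf1 hs x
  set lam := (mom f 0 s x / mom f 0 t x) ^ (1 / (N : ℝ)) with hlam
  have hl : 0 < lam := by positivity
  have hlN : lam ^ N = mom f 0 s x / mom f 0 t x := by
    rw [hlam, one_div]
    exact Real.rpow_inv_natCast_pow (by positivity) hN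
  have key : wt f 4 t x ≤ lam * mom f 0 t x + lam * (lam ^ N)⁻¹ * C * mom f 0 s x := by
    unfold wt mom
    rw [← integral_const_mul, ← integral_const_mul, ← integral_add]
    · refine integral_mono (wt_integrable hfi 4 ht x)
        (((mom_integrable hfi 0 ht x).const_mul _).add ((mom_integrable hfi 0 hs x).const_mul _))
        fun y => ?_
      have g0 := (gK_pos ht (x - y)).le
      have e1 := young_aux (W := (1 + (x - y) ^ 2) ^ 4) (by positivity) hl hN
      have e2 := h t a b (x - y)
      have e3 := mul_le_mul_of_nonneg_right e1 g0
      have e4 := mul_le_mul_of_nonneg_left e2 (show 0 ≤ lam * (lam ^ N)⁻¹ by positivity)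
      rw [pow_mul] at e4
      have e5 : (1 + (x - y) ^ 2) ^ 4 * gK t (x - y) ≤ lam * gK t (x - y) +
          lam * (lam ^ N)⁻¹ * (C * gK s (x - y)) := by
        refine e3.trans ?_
        linarith
      have e6 := mul_le_mul_of_nonneg_left e5 (hf0 y)
      simp only [pow_zero, one_mul]
      linarith
    · exact (mom_integrable hfi 0 ht x).const_mul _
    · exact (mom_integrable hfi 0 hs x).const_mul _
  refine key.trans (le_of_eq ?_)
  rw [hlN]
  field_simp

lemma mom_le_wt {f : ℝ → ℝ} (hf0 : ∀ x, 0 ≤ f x) (hfi : Integrable f) {t : ℝ} (ht : 0 < t)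
    (x : ℝ) {k : ℕ} (hk : k ≤ 4) : |mom f k t x| ≤ wt f 4 t x := by
  unfold mom wt
  refine (abs_integral_le_integral_abs).trans ?_
  refine integral_mono (mom_integrable hfi k ht x).abs (wt_integrable hfi 4 ht x) fun y => ?_
  have g0 := (gK_pos ht (x - y)).le
  simp only [abs_mul, abs_of_nonneg g0, abs_of_nonneg (hf0 y)]
  have := (abs_pow_le_w (x - y) k).trans (w_mono _ hk)
  exact mul_le_mul_of_nonneg_left (mul_le_mul_of_nonneg_right this g0) (hf0 y)

lemma qS_le {f : ℝ → ℝ} (hf0 : ∀ x, 0 ≤ f x) (hf1 : (∫ x : ℝ, f x) = 1)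
    {t₁ : ℝ} (h1 : 0 < t₁) : ∃ D : ℝ, 0 < D ∧ ∀ t, t₁ ≤ t → ∀ x,
      qS f t x ≤ D * (wt f 4 t x / mom f 0 t x) := by
  have hfi := integrable_of_int_one hf1
  refine ⟨1 + 1 / t₁ + (1 / t₁ ^ 2 + 1 / t₁) + (1 / t₁ ^ 3 + 3 / t₁ ^ 2) +
    (1 / t₁ ^ 4 + 6 / t₁ ^ 3 + 3 / t₁ ^ 2), by positivity, fun t a x => ?_⟩
  have ht : 0 < t := by linarith
  have pt := mom_pos hf0 hf1 ht x
  have hw : ∀ k ≤ 4, |mom f k t x| ≤ wt f 4 t x := fun k hk => mom_le_wt hf0 hfi ht x hk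
  set w := wt f 4 t x
  have hw0 : 0 ≤ w := (abs_nonneg _).trans (hw 0 (by norm_num))
  have i1 : ∀ (k : ℕ), k ≤ 4 → ∀ (n : ℕ), |mom f k t x| / t ^ n ≤ w / t₁ ^ n := by
    intro k hk n
    have := hw k hk
    gcongr
  have b1 : |(-mom f 1 t x / t)| ≤ 1 / t₁ * w := by
    have := i1 1 (by norm_num) 1
    rw [pow_one, pow_one] at this
    rw [abs_div, abs_neg, abs_of_pos ht]
    exact this.trans (le_of_eq (by ring))
  have b2 : |mom f 2 t x / t ^ 2 - mom f 0 t x / t| ≤ (1 / t₁ ^ 2 + 1 / t₁) * w := by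
    refine (abs_sub _ _).trans ?_
    have c1 := i1 2 (by norm_num) 2
    have c2 := i1 0 (by norm_num) 1
    rw [pow_one, pow_one] at c2
    rw [abs_div, abs_div, abs_of_pos ht, abs_of_pos (pow_pos ht 2)]
    exact (add_le_add c1 c2).trans (le_of_eq (by ring))
  have b3 : |(-mom f 3 t x / t ^ 3 + 3 * mom f 1 t x / t ^ 2)| ≤ (1 / t₁ ^ 3 + 3 / t₁ ^ 2) * w := by
    refine (abs_add_le _ _).trans ?_
    have c1 := i1 3 (by norm_num) 3
    have c2 := i1 1 (by norm_num) 2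
    rw [abs_div, abs_div, abs_neg, abs_mul, abs_of_pos (pow_pos ht 3), abs_of_pos (pow_pos ht 2),
      abs_of_pos (by norm_num : (0:ℝ) < 3), mul_div_assoc]
    have := mul_le_mul_of_nonneg_left c2 (by norm_num : (0:ℝ) ≤ 3)
    exact (add_le_add c1 this).trans (le_of_eq (by ring))
  have b4 : |mom f 4 t x / t ^ 4 - 6 * mom f 2 t x / t ^ 3 + 3 * mom f 0 t x / t ^ 2| ≤
      (1 / t₁ ^ 4 + 6 / t₁ ^ 3 + 3 / t₁ ^ 2) * w := by
    refine (abs_add_le _ _).trans ((add_le_add_left (abs_sub _ _) _).trans ?_)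
    have c1 := i1 4 (by norm_num) 4
    have c2 := i1 2 (by norm_num) 3
    have c3 := i1 0 (by norm_num) 2
    rw [abs_div, abs_div, abs_div, abs_mul, abs_mul, abs_of_pos (pow_pos ht 4),
      abs_of_pos (pow_pos ht 3), abs_of_pos (pow_pos ht 2),
      abs_of_pos (by norm_num : (0:ℝ) < 3), abs_of_pos (by norm_num : (0:ℝ) < 6),
      mul_div_assoc, mul_div_assoc]
    have d1 := mul_le_mul_of_nonneg_left c2 (by norm_num : (0:ℝ) ≤ 6)
    have d2 := mul_le_mul_of_nonneg_left c3 (by norm_num : (0:ℝ) ≤ 3)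
    exact (add_le_add (add_le_add c1 d1) d2).trans (le_of_eq (by ring))
  have b0 : mom f 0 t x ≤ w := (le_abs_self _).trans (hw 0 (by norm_num))
  unfold qS q1 q2 q3 q4
  rw [abs_div _ (mom f 0 t x), abs_div _ (mom f 0 t x), abs_div _ (mom f 0 t x),
    abs_div _ (mom f 0 t x), abs_of_pos pt, ← mul_div_assoc, le_div_iff₀ pt]
  simp only [add_mul, div_mul_cancel₀ _ pt.ne']
  linarith

lemma dom {f : ℝ → ℝ} (hf0 : ∀ x, 0 ≤ f x) (hf1 : (∫ x : ℝ, f x) = 1)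
    {α : ℝ} (hα : 0 < α)
    {t₁ t₂ s : ℝ} (h1 : 0 < t₁) (h2 : t₁ < t₂) (h3 : t₂ < s) :
    ∃ C : ℝ, 0 < C ∧ ∀ t, t₁ ≤ t → t ≤ t₂ → ∀ x,
      mom f 0 t x ^ α * qS f t x ^ 4 ≤ C * mom f 0 s x ^ α := by
  obtain ⟨N, hN⟩ := exists_nat_gt (4 / α)
  have hN0 : (0 : ℝ) < N := lt_trans (by positivity) hN
  have hN0' : N ≠ 0 := by rintro rfl; simp at hN0
  obtain ⟨C1, hC1, m1⟩ := p_mono hf0 hf1 h1 h2 h3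
  obtain ⟨C2, hC2, m2⟩ := wt_le hf0 hf1 h1 h2 h3 hN0'
  obtain ⟨D, hD, m3⟩ := qS_le hf0 hf1 h1
  have hs : 0 < s := by linarith
  set δ : ℝ := 4 / N with hδ
  have hδα : δ ≤ α := by
    rw [hδ, div_le_iff₀ hN0]
    rw [div_lt_iff₀ hα] at hN
    linarith
  refine ⟨(D * C2) ^ 4 * C1 ^ (α - δ), by positivity, fun t a b x => ?_⟩
  have ht : 0 < t := by linarith
  have pt := mom_pos hf0 hf1 ht x
  have ps := mom_pos hf0 hf1 hs x
  set p := mom f 0 t x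
  set r := mom f 0 s x
  have e1 : qS f t x ≤ D * C2 * (r / p) ^ (1 / (N : ℝ)) := by
    refine (m3 t a x).trans ?_
    rw [mul_assoc]
    refine mul_le_mul_of_nonneg_left ?_ hD.le
    rw [div_le_iff₀ pt]
    exact m2 t a b x
  have e0 : 0 ≤ qS f t x := by unfold qS; positivity
  have e2 : qS f t x ^ 4 ≤ (D * C2) ^ 4 * (r / p) ^ δ := by
    refine (pow_le_pow_left₀ e0 e1 4).trans (le_of_eq ?_)
    rw [mul_pow _ _ 4, ← Real.rpow_natCast ((r / p) ^ (1 / (N : ℝ))), ← Real.rpow_mul (by positivity)]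
    congr 2
    rw [hδ]; push_cast; ring
  have e3 : p ^ α * (r / p) ^ δ = r ^ δ * p ^ (α - δ) := by
    rw [Real.div_rpow ps.le pt.le, Real.rpow_sub pt]
    ring
  have e4 : p ^ (α - δ) ≤ (C1 * r) ^ (α - δ) :=
    Real.rpow_le_rpow pt.le (m1 t a b x) (by linarith)
  have e5 : r ^ δ * r ^ (α - δ) = r ^ α := by
    rw [← Real.rpow_add ps]; congr 1; ring
  calc p ^ α * qS f t x ^ 4 ≤ p ^ α * ((D * C2) ^ 4 * (r / p) ^ δ) := by gcongr
    _ = (D * C2) ^ 4 * (r ^ δ * p ^ (α - δ)) := by rw [← e3]; ring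
    _ ≤ (D * C2) ^ 4 * (r ^ δ * (C1 * r) ^ (α - δ)) := by gcongr
    _ = (D * C2) ^ 4 * C1 ^ (α - δ) * (r ^ δ * r ^ (α - δ)) := by
        rw [Real.mul_rpow hC1.le ps.le]; ring
    _ = _ := by rw [e5]

/-! ### Integrals -/

lemma q1_cont {f : ℝ → ℝ} (hf0 : ∀ x, 0 ≤ f x) (hf1 : (∫ x : ℝ, f x) = 1)
    {t : ℝ} (ht : 0 < t) : Continuous (q1 f t) :=
  continuous_iff_continuousAt.2 fun x =>
    (q1_dx (integrable_of_int_one hf1) ht x (mom_pos hf0 hf1 ht x)).continuousAt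

lemma q2_cont {f : ℝ → ℝ} (hf0 : ∀ x, 0 ≤ f x) (hf1 : (∫ x : ℝ, f x) = 1)
    {t : ℝ} (ht : 0 < t) : Continuous (q2 f t) :=
  continuous_iff_continuousAt.2 fun x =>
    (q2_dx (integrable_of_int_one hf1) ht x (mom_pos hf0 hf1 ht x)).continuousAt

lemma q3_cont {f : ℝ → ℝ} (hf0 : ∀ x, 0 ≤ f x) (hf1 : (∫ x : ℝ, f x) = 1)
    {t : ℝ} (ht : 0 < t) : Continuous (q3 f t) :=
  continuous_iff_continuousAt.2 fun x =>
    (q3_dx (integrable_of_int_one hf1) ht x (mom_pos hf0 hf1 ht x)).continuousAt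

lemma q4_cont {f : ℝ → ℝ} (hf0 : ∀ x, 0 ≤ f x) (hf1 : (∫ x : ℝ, f x) = 1)
    {t : ℝ} (ht : 0 < t) : Continuous (q4 f t) := by
  have hfi := integrable_of_int_one hf1
  have h0 := mom_cont hfi 0 ht
  have h2 := mom_cont hfi 2 ht
  have h4 := mom_cont hfi 4 ht
  unfold q4
  exact Continuous.div (by fun_prop) h0 fun x => (mom_pos hf0 hf1 ht x).ne'

lemma pa_cont {f : ℝ → ℝ} (hf0 : ∀ x, 0 ≤ f x) (hf1 : (∫ x : ℝ, f x) = 1)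
    {t : ℝ} (ht : 0 < t) (α : ℝ) : Continuous (fun x => mom f 0 t x ^ α) :=
  (mom_cont (integrable_of_int_one hf1) 0 ht).rpow_const
    fun x => Or.inl (mom_pos hf0 hf1 ht x).ne'

lemma pa_dx {f : ℝ → ℝ} (hf0 : ∀ x, 0 ≤ f x) (hf1 : (∫ x : ℝ, f x) = 1)
    {t : ℝ} (ht : 0 < t) (α x : ℝ) :
    HasDerivAt (fun x => mom f 0 t x ^ α) (mom f 0 t x ^ α * (α * q1 f t x)) x := by
  have hp := mom_pos hf0 hf1 ht x
  have := (p_dx (integrable_of_int_one hf1) ht x hp).rpow_const (p := α) (Or.inl hp.ne')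
  refine this.congr_deriv ?_
  rw [Real.rpow_sub_one hp.ne']
  field_simp

lemma pa_dt {f : ℝ → ℝ} (hf0 : ∀ x, 0 ≤ f x) (hf1 : (∫ x : ℝ, f x) = 1)
    {t : ℝ} (ht : 0 < t) (α x : ℝ) :
    HasDerivAt (fun t => mom f 0 t x ^ α) (mom f 0 t x ^ α * (α / 2 * q2 f t x)) t := by
  have hp := mom_pos hf0 hf1 ht x
  have := (p_dt (integrable_of_int_one hf1) ht x hp).rpow_const (p := α) (Or.inl hp.ne')
  refine this.congr_deriv ?_
  rw [Real.rpow_sub_one hp.ne']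
  field_simp

lemma qS_ge {f : ℝ → ℝ} (t x : ℝ) : |(1 : ℝ)| ≤ qS f t x ∧ |q1 f t x| ≤ qS f t x ∧ |q2 f t x| ≤ qS f t x ∧
    |q3 f t x| ≤ qS f t x ∧ |q4 f t x| ≤ qS f t x := by
  have h1 := abs_nonneg (q1 f t x)
  have h2 := abs_nonneg (q2 f t x)
  have h3 := abs_nonneg (q3 f t x)
  have h4 := abs_nonneg (q4 f t x)
  rw [abs_one]
  unfold qS
  refine ⟨?_, ?_, ?_, ?_, ?_⟩ <;> linarith

lemma mono4 {a b c d S : ℝ} (ha : |a| ≤ S) (hb : |b| ≤ S) (hc : |c| ≤ S) (hd : |d| ≤ S) :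
    |a * b * c * d| ≤ S ^ 4 := by
  rw [abs_mul, abs_mul, abs_mul]
  have hS := (abs_nonneg a).trans ha
  calc |a| * |b| * |c| * |d| ≤ S * S * S * S := by gcongr
    _ = S ^ 4 := by ring

lemma int4 {f : ℝ → ℝ} (hf0 : ∀ x, 0 ≤ f x) (hf1 : (∫ x : ℝ, f x) = 1)
    {α : ℝ} (hα : 0 < α)
    {t s : ℝ} (ht : 0 < t) (hts : t < s) (hs : Integrable (fun x => mom f 0 s x ^ α))
    {a b c d : ℝ → ℝ} (ca : Continuous a) (cb : Continuous b) (cc : Continuous c)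
    (cd : Continuous d) (ha : ∀ x, |a x| ≤ qS f t x) (hb : ∀ x, |b x| ≤ qS f t x)
    (hc : ∀ x, |c x| ≤ qS f t x) (hd : ∀ x, |d x| ≤ qS f t x) :
    Integrable (fun x => mom f 0 t x ^ α * (a x * b x * c x * d x)) := by
  obtain ⟨C, hC, h⟩ := dom hf0 hf1 hα (half_pos ht) (show t / 2 < t by linarith) hts
  have hpc := pa_cont hf0 hf1 ht α
  refine (hs.const_mul C).mono' (Continuous.aestronglyMeasurable (by fun_prop))
    (Eventually.of_forall fun x => ?_)
  have hp := Real.rpow_pos_of_pos (mom_pos hf0 hf1 ht x) α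
  rw [Real.norm_eq_abs, abs_mul, abs_of_pos hp]
  exact (mul_le_mul_of_nonneg_left (mono4 (ha x) (hb x) (hc x) (hd x)) hp.le).trans
    (h t (by linarith) le_rfl x)

lemma dF {f : ℝ → ℝ} (hf0 : ∀ x, 0 ≤ f x) (hf1 : (∫ x : ℝ, f x) = 1)
    {α : ℝ} (hα : 0 < α)
    {t s : ℝ} (ht : 0 < t) (hts : t < s) (hs : Integrable (fun x => mom f 0 s x ^ α)) :
    HasDerivAt (fun t => ∫ x, mom f 0 t x ^ α) (∫ x, mom f 0 t x ^ α * (α / 2 * q2 f t x)) t := by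
  obtain ⟨C, hC, h⟩ := dom hf0 hf1 hα (t₁ := t / 2) (t₂ := (t + s) / 2) (s := s)
    (by linarith) (by linarith) (by linarith)
  have c1 := pa_cont hf0 hf1 ht α
  have c2 := q2_cont hf0 hf1 ht
  refine (hasDerivAt_integral_of_dominated_loc_of_deriv_le (μ := volume)
    (s := Set.Ioo (t / 2) ((t + s) / 2))
    (F := fun t x => mom f 0 t x ^ α)
    (F' := fun t x => mom f 0 t x ^ α * (α / 2 * q2 f t x)) (x₀ := t)
    (bound := fun x => α / 2 * (C * mom f 0 s x ^ α))
    (Ioo_mem_nhds (by linarith) (by linarith))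
    (Filter.mem_of_superset (lt_mem_nhds ht)
      fun u hu => (pa_cont hf0 hf1 hu α).aestronglyMeasurable) ?_
    (Continuous.aestronglyMeasurable (by fun_prop))
    (Eventually.of_forall fun x u hu => ?_) ((hs.const_mul _).const_mul _)
    (Eventually.of_forall fun x u hu => ?_)).2
  · have := int4 hf0 hf1 hα ht hts hs (a := fun _ => 1) (b := fun _ => 1) (c := fun _ => 1)
      (d := fun _ => 1) continuous_const continuous_const continuous_const continuous_const
      (fun x => (qS_ge t x).1) (fun x => (qS_ge t x).1) (fun x => (qS_ge t x).1)
      (fun x => (qS_ge t x).1)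
    simpa using this
  · have hu0 : 0 < u := by have := hu.1; linarith
    have hp := Real.rpow_pos_of_pos (mom_pos hf0 hf1 hu0 x) α
    obtain ⟨e1, e2, e3, e4, e5⟩ := qS_ge (f := f) u x
    have := mono4 e3 e1 e1 e1
    simp only [mul_one] at this
    have k := (mul_le_mul_of_nonneg_left this hp.le).trans (h u hu.1.le hu.2.le x)
    rw [Real.norm_eq_abs, abs_mul, abs_mul, abs_of_pos hp, abs_of_pos (half_pos hα)]
    calc _ = α / 2 * (mom f 0 u x ^ α * |q2 f u x|) := by ring
      _ ≤ _ := by gcongr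
  · have hu0 : 0 < u := by have := hu.1; linarith
    exact pa_dt hf0 hf1 hu0 α x

lemma dF1 {f : ℝ → ℝ} (hf0 : ∀ x, 0 ≤ f x) (hf1 : (∫ x : ℝ, f x) = 1)
    {α : ℝ} (hα : 0 < α)
    {t s : ℝ} (ht : 0 < t) (hts : t < s) (hs : Integrable (fun x => mom f 0 s x ^ α)) :
    HasDerivAt (fun t => ∫ x, mom f 0 t x ^ α * (α / 2 * q2 f t x))
      (∫ x, mom f 0 t x ^ α * (α / 4 * ((α - 1) * q2 f t x ^ 2 + q4 f t x))) t := by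
  obtain ⟨C, hC, h⟩ := dom hf0 hf1 hα (t₁ := t / 2) (t₂ := (t + s) / 2) (s := s)
    (by linarith) (by linarith) (by linarith)
  have c1 := pa_cont hf0 hf1 ht α
  have c2 := q2_cont hf0 hf1 ht
  have c4 := q4_cont hf0 hf1 ht
  refine (hasDerivAt_integral_of_dominated_loc_of_deriv_le (μ := volume)
    (s := Set.Ioo (t / 2) ((t + s) / 2))
    (F := fun t x => mom f 0 t x ^ α * (α / 2 * q2 f t x))
    (F' := fun t x => mom f 0 t x ^ α * (α / 4 * ((α - 1) * q2 f t x ^ 2 + q4 f t x))) (x₀ := t)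
    (bound := fun x => α / 4 * (|α - 1| + 1) * (C * mom f 0 s x ^ α))
    (Ioo_mem_nhds (by linarith) (by linarith))
    (Filter.mem_of_superset (lt_mem_nhds ht)
      fun u hu => ?_) ?_
    (Continuous.aestronglyMeasurable (by fun_prop))
    (Eventually.of_forall fun x u hu => ?_) ((hs.const_mul _).const_mul _)
    (Eventually.of_forall fun x u hu => ?_)).2
  · have d1 := pa_cont hf0 hf1 hu α
    have d2 := q2_cont hf0 hf1 hu
    exact Continuous.aestronglyMeasurable (by fun_prop)
  · have := int4 hf0 hf1 hα ht hts hs (a := q2 f t) (b := fun _ => 1) (c := fun _ => 1)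
      (d := fun _ => 1) c2 continuous_const continuous_const continuous_const
      (fun x => (qS_ge t x).2.2.1) (fun x => (qS_ge t x).1) (fun x => (qS_ge t x).1)
      (fun x => (qS_ge t x).1)
    refine (this.const_mul (α / 2)).congr (Eventually.of_forall fun x => ?_)
    simp only; ring
  · have hu0 : 0 < u := by have := hu.1; linarith
    have hp := Real.rpow_pos_of_pos (mom_pos hf0 hf1 hu0 x) α
    obtain ⟨e1, e2, e3, e4, e5⟩ := qS_ge (f := f) u x
    have k1 := mono4 e3 e3 e1 e1
    have k2 := mono4 e5 e1 e1 e1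
    simp only [mul_one] at k1 k2
    have k0 := h u hu.1.le hu.2.le x
    rw [Real.norm_eq_abs, abs_mul, abs_mul, abs_of_pos hp,
      abs_of_pos (show 0 < α / 4 by positivity)]
    have k3 : |(α - 1) * q2 f u x ^ 2 + q4 f u x| ≤ (|α - 1| + 1) * qS f u x ^ 4 := by
      refine (abs_add_le _ _).trans ?_
      rw [abs_mul, pow_two]
      have := mul_le_mul_of_nonneg_left k1 (abs_nonneg (α - 1))
      linarith
    calc _ ≤ mom f 0 u x ^ α * (α / 4 * ((|α - 1| + 1) * qS f u x ^ 4)) := by gcongr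
      _ = α / 4 * (|α - 1| + 1) * (mom f 0 u x ^ α * qS f u x ^ 4) := by ring
      _ ≤ _ := by gcongr
  · have hu0 : 0 < u := by have := hu.1; linarith
    have hp := mom_pos hf0 hf1 hu0 x
    have := (pa_dt hf0 hf1 hu0 α x).mul
      ((q2_dt (integrable_of_int_one hf1) hu0 x hp).const_mul (α / 2))
    refine this.congr_deriv ?_
    ring

/-- The elementary choice of the multiplier `mu`. -/
lemma exists_mu {α : ℝ} (hα : 0 < α) (hαu : α ≤ 3 / 2 + Real.sqrt 2) :
    ∃ mu : ℝ, 1 / 2 ≤ mu ∧ 9 * mu ^ 2 - mu * (12 - 2 * α) + (α - 2) ^ 2 ≤ 0 := by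
  rcases le_total α (3 / 2) with h | h
  · refine ⟨(6 - α) / 9, by linarith, ?_⟩
    nlinarith
  · refine ⟨1 / 2, le_rfl, ?_⟩
    have h2 : Real.sqrt 2 ^ 2 = 2 := Real.sq_sqrt (by norm_num)
    have := Real.sqrt_nonneg 2
    nlinarith

lemma main_ineq {f : ℝ → ℝ} (hf0 : ∀ x, 0 ≤ f x) (hf1 : (∫ x : ℝ, f x) = 1)
    {α : ℝ} (hα : 0 < α)
    (hαu : α ≤ 3 / 2 + Real.sqrt 2) {t s : ℝ} (ht : 0 < t) (hts : t < s)
    (hs : Integrable (fun x => mom f 0 s x ^ α)) :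
    0 < (∫ x, mom f 0 t x ^ α) ∧ ∃ m J : ℝ,
      (∫ x, mom f 0 t x ^ α * (α / 2 * q2 f t x)) = α / 2 * (1 - α) * m ∧
      (∫ x, mom f 0 t x ^ α * (α / 4 * ((α - 1) * q2 f t x ^ 2 + q4 f t x)))
        = α * (α - 1) / 4 * J ∧
      α ^ 2 * m ^ 2 ≤ (∫ x, mom f 0 t x ^ α) * J := by
  have hfi := integrable_of_int_one hf1
  have c1 := q1_cont hf0 hf1 ht
  have c2 := q2_cont hf0 hf1 ht
  have c3 := q3_cont hf0 hf1 ht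
  have c4 := q4_cont hf0 hf1 ht
  have c0 : Continuous (fun _ : ℝ => (1 : ℝ)) := continuous_const
  have b0 : ∀ x, |(1 : ℝ)| ≤ qS f t x := fun x => (qS_ge t x).1
  have b1 : ∀ x, |q1 f t x| ≤ qS f t x := fun x => (qS_ge t x).2.1
  have b2 : ∀ x, |q2 f t x| ≤ qS f t x := fun x => (qS_ge t x).2.2.1
  have b3 : ∀ x, |q3 f t x| ≤ qS f t x := fun x => (qS_ge t x).2.2.2.1
  have b4 : ∀ x, |q4 f t x| ≤ qS f t x := fun x => (qS_ge t x).2.2.2.2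
  set P : ℝ → ℝ := fun x => mom f 0 t x ^ α with hP
  have hPpos : ∀ x, 0 < P x := fun x => Real.rpow_pos_of_pos (mom_pos hf0 hf1 ht x) α
  have I0 : Integrable P := by
    have := int4 hf0 hf1 hα ht hts hs c0 c0 c0 c0 b0 b0 b0 b0
    simpa using this
  have Iq1 : Integrable (fun x => P x * q1 f t x) := by
    have := int4 hf0 hf1 hα ht hts hs c1 c0 c0 c0 b1 b0 b0 b0
    simpa using this
  have Iq2 : Integrable (fun x => P x * q2 f t x) := by
    have := int4 hf0 hf1 hα ht hts hs c2 c0 c0 c0 b2 b0 b0 b0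
    simpa using this
  have Iq3 : Integrable (fun x => P x * q3 f t x) := by
    have := int4 hf0 hf1 hα ht hts hs c3 c0 c0 c0 b3 b0 b0 b0
    simpa using this
  have Iq4 : Integrable (fun x => P x * q4 f t x) := by
    have := int4 hf0 hf1 hα ht hts hs c4 c0 c0 c0 b4 b0 b0 b0
    simpa using this
  have I11 : Integrable (fun x => P x * q1 f t x ^ 2) := by
    have := int4 hf0 hf1 hα ht hts hs c1 c1 c0 c0 b1 b1 b0 b0
    refine this.congr (Eventually.of_forall fun x => ?_)
    simp only [hP]; ring
  have I22 : Integrable (fun x => P x * q2 f t x ^ 2) := by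
    have := int4 hf0 hf1 hα ht hts hs c2 c2 c0 c0 b2 b2 b0 b0
    refine this.congr (Eventually.of_forall fun x => ?_)
    simp only [hP]; ring
  have I12 : Integrable (fun x => P x * (q1 f t x * q2 f t x)) := by
    have := int4 hf0 hf1 hα ht hts hs c1 c2 c0 c0 b1 b2 b0 b0
    refine this.congr (Eventually.of_forall fun x => ?_)
    simp only [hP]; ring
  have I111 : Integrable (fun x => P x * q1 f t x ^ 3) := by
    have := int4 hf0 hf1 hα ht hts hs c1 c1 c1 c0 b1 b1 b1 b0
    refine this.congr (Eventually.of_forall fun x => ?_)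
    simp only [hP]; ring
  have I112 : Integrable (fun x => P x * (q1 f t x ^ 2 * q2 f t x)) := by
    have := int4 hf0 hf1 hα ht hts hs c1 c1 c2 c0 b1 b1 b2 b0
    refine this.congr (Eventually.of_forall fun x => ?_)
    simp only [hP]; ring
  have I1111 : Integrable (fun x => P x * q1 f t x ^ 4) := by
    have := int4 hf0 hf1 hα ht hts hs c1 c1 c1 c1 b1 b1 b1 b1
    refine this.congr (Eventually.of_forall fun x => ?_)
    simp only [hP]; ring
  have dP : ∀ x, HasDerivAt P (P x * (α * q1 f t x)) x := fun x => pa_dx hf0 hf1 ht α x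
  have d1 : ∀ x, HasDerivAt (q1 f t) (q2 f t x - q1 f t x ^ 2) x :=
    fun x => q1_dx hfi ht x (mom_pos hf0 hf1 ht x)
  have d2 : ∀ x, HasDerivAt (q2 f t) (q3 f t x - q1 f t x * q2 f t x) x :=
    fun x => q2_dx hfi ht x (mom_pos hf0 hf1 ht x)
  have d3 : ∀ x, HasDerivAt (q3 f t) (q4 f t x - q1 f t x * q3 f t x) x :=
    fun x => q3_dx hfi ht x (mom_pos hf0 hf1 ht x)
  -- first integration by parts
  have ibp1 : (∫ x, P x * q2 f t x) = (1 - α) * ∫ x, P x * q1 f t x ^ 2 := by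
    have J1 := (Iq2.add (I11.const_mul (α - 1)))
    have := integral_eq_zero_of_hasDerivAt_of_integrable
      (f := fun x => P x * q1 f t x)
      (f' := fun x => P x * q2 f t x + (α - 1) * (P x * q1 f t x ^ 2))
      (fun x => ((dP x).mul (d1 x)).congr_deriv (by ring)) J1 Iq1
    rw [integral_add Iq2 (I11.const_mul _), integral_const_mul] at this
    linarith
  have ibp2 : 3 * (∫ x, P x * (q1 f t x ^ 2 * q2 f t x)) = (3 - α) * ∫ x, P x * q1 f t x ^ 4 := by
    have J1 := ((I112.const_mul 3).add (I1111.const_mul (α - 3)))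
    have := integral_eq_zero_of_hasDerivAt_of_integrable
      (f := fun x => P x * q1 f t x ^ 3)
      (f' := fun x => 3 * (P x * (q1 f t x ^ 2 * q2 f t x)) + (α - 3) * (P x * q1 f t x ^ 4))
      (fun x => ((dP x).mul ((d1 x).fun_pow 3)).congr_deriv (by push_cast; ring)) J1 I111
    rw [integral_add (I112.const_mul _) (I1111.const_mul _), integral_const_mul,
      integral_const_mul] at this
    linarith
  have ibp3 : (∫ x, P x * q4 f t x) = (α - 1) * (α - 2) * (∫ x, P x * (q1 f t x ^ 2 * q2 f t x))
      + (α - 1) * ∫ x, P x * q2 f t x ^ 2 := by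
    have Ja := (I112.const_mul ((α - 1) * (α - 2))).fun_add (I22.const_mul (α - 1))
    have J1 := Iq4.sub Ja
    have := integral_eq_zero_of_hasDerivAt_of_integrable
      (f := fun x => P x * (q3 f t x - (α - 1) * (q1 f t x * q2 f t x)))
      (f' := fun x => P x * q4 f t x - ((α - 1) * (α - 2) * (P x * (q1 f t x ^ 2 * q2 f t x))
        + (α - 1) * (P x * q2 f t x ^ 2)))
      (fun x => ((dP x).mul ((d3 x).sub (((d1 x).mul (d2 x)).const_mul (α - 1)))).congr_deriv
        (by simp only [Pi.sub_apply, Pi.mul_apply]; ring)) J1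
      ((Iq3.sub (I12.const_mul (α - 1))).congr (Eventually.of_forall fun x => by
        simp only [Pi.sub_apply]; ring))
    rw [integral_sub Iq4 Ja, integral_add (I112.const_mul _) (I22.const_mul _),
      integral_const_mul, integral_const_mul] at this
    linarith
  set F := ∫ x, P x with hF
  set m := ∫ x, P x * q1 f t x ^ 2 with hm
  set A := ∫ x, P x * q2 f t x ^ 2 with hA
  set B := ∫ x, P x * (q1 f t x ^ 2 * q2 f t x) with hB
  set D := ∫ x, P x * q1 f t x ^ 4 with hD
  have Fpos : 0 < F := by
    rw [hF, integral_pos_iff_support_of_nonneg (fun x => (hPpos x).le) I0]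
    have : Function.support P = Set.univ := by
      ext x; simp [(hPpos x).ne']
    rw [this]; simp
  refine ⟨Fpos, m, 2 * A + (α - 2) * B, ?_, ?_, ?_⟩
  · have : (∫ x, P x * (α / 2 * q2 f t x)) = α / 2 * ∫ x, P x * q2 f t x := by
      rw [← integral_const_mul]; congr 1; ext x; ring
    rw [this, ibp1]; ring
  · have : (∫ x, P x * (α / 4 * ((α - 1) * q2 f t x ^ 2 + q4 f t x)))
        = α / 4 * ((α - 1) * A + ∫ x, P x * q4 f t x) := by
      rw [hA, ← integral_const_mul, ← integral_add (I22.const_mul _) Iq4, ← integral_const_mul]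
      congr 1; ext x; ring
    rw [this, ibp3]; ring
  · obtain ⟨mu, hmu, hq⟩ := exists_mu hα hαu
    -- the quadratic form
    set e := α - 2 - 3 * mu with he
    set g := mu * (3 - α) with hg
    have hdisc : e ^ 2 ≤ 8 * g := by rw [he, hg]; nlinarith
    set c2 := m / F with hc2
    set c1 := (1 - α) * c2 with hc1
    have hnn : 0 ≤ ∫ x, P x * (2 * (q2 f t x - c1) ^ 2
        + e * ((q2 f t x - c1) * (q1 f t x ^ 2 - c2)) + g * (q1 f t x ^ 2 - c2) ^ 2) := by
      refine integral_nonneg fun x => mul_nonneg (hPpos x).le ?_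
      nlinarith [sq_nonneg (4 * (q2 f t x - c1) + e * (q1 f t x ^ 2 - c2)),
        mul_nonneg (sub_nonneg.2 hdisc) (sq_nonneg (q1 f t x ^ 2 - c2))]
    have hexp : (∫ x, P x * (2 * (q2 f t x - c1) ^ 2
        + e * ((q2 f t x - c1) * (q1 f t x ^ 2 - c2)) + g * (q1 f t x ^ 2 - c2) ^ 2))
        = 2 * A + e * B + g * D + (-4 * c1 - e * c2) * ((1 - α) * m) +
          (-e * c1 - 2 * g * c2) * m + (2 * c1 ^ 2 + e * c1 * c2 + g * c2 ^ 2) * F := by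
      rw [← ibp1, hA, hB, hD, hm, hF]
      have K1 := I22.const_mul 2
      have K2 := I112.const_mul e
      have K3 := I1111.const_mul g
      have K4 := Iq2.const_mul (-4 * c1 - e * c2)
      have K5 := I11.const_mul (-e * c1 - 2 * g * c2)
      have K6 := I0.const_mul (2 * c1 ^ 2 + e * c1 * c2 + g * c2 ^ 2)
      rw [← integral_const_mul, ← integral_const_mul, ← integral_const_mul, ← integral_const_mul,
        ← integral_const_mul, ← integral_const_mul, ← integral_add K1 K2,
        ← integral_add (K1.fun_add K2) K3, ← integral_add ((K1.fun_add K2).fun_add K3) K4,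
        ← integral_add (((K1.fun_add K2).fun_add K3).fun_add K4) K5,
        ← integral_add ((((K1.fun_add K2).fun_add K3).fun_add K4).fun_add K5) K6]
      congr 1
      ext x
      ring
    rw [hexp] at hnn
    have hmF : m = c2 * F := by rw [hc2]; field_simp
    have hD' : g * D = mu * (3 * B) := by rw [hg, ibp2]; ring
    have h5 : 0 ≤ 2 * A + (α - 2) * B - (2 * (1 - α) ^ 2 + e * (1 - α) + g) * (c2 ^ 2 * F) := by
      have : 2 * A + (α - 2) * B - (2 * (1 - α) ^ 2 + e * (1 - α) + g) * (c2 ^ 2 * F)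
        = 2 * A + e * B + g * D + (-4 * c1 - e * c2) * ((1 - α) * m) +
          (-e * c1 - 2 * g * c2) * m + (2 * c1 ^ 2 + e * c1 * c2 + g * c2 ^ 2) * F := by
        rw [hD', hmF, hc1, he]; ring
      rw [this]; exact hnn
    have h6 : α ^ 2 ≤ 2 * (1 - α) ^ 2 + e * (1 - α) + g := by
      rw [he, hg]; nlinarith
    have h7 : α ^ 2 * (c2 ^ 2 * F) ≤ 2 * A + (α - 2) * B :=
      (mul_le_mul_of_nonneg_right h6 (by positivity)).trans (by linarith)
    calc α ^ 2 * m ^ 2 = F * (α ^ 2 * (c2 ^ 2 * F)) := by rw [hmF]; ring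
      _ ≤ _ := mul_le_mul_of_nonneg_left h7 Fpos.le


/-! ### General lemmas on concave functions -/

/-- The second derivative (with junk values) of a concave function is nonpositive. -/
lemma iteratedDeriv_two_nonpos_of_concaveOn {g : ℝ → ℝ} {U : Set ℝ} (hU : IsOpen U)
    (hg : ConcaveOn ℝ U g) {t : ℝ} (ht : t ∈ U) : iteratedDeriv 2 g t ≤ 0 := by
  have e : iteratedDeriv 2 g t = deriv (deriv g) t := by
    rw [iteratedDeriv_succ, iteratedDeriv_one]
  rw [e]
  by_contra! hc
  have hd : HasDerivAt (deriv g) (deriv (deriv g) t) t :=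
    (differentiableAt_of_deriv_ne_zero hc.ne').hasDerivAt
  have hsl := (hasDerivAt_iff_tendsto_slope.1 hd).eventually (lt_mem_nhds hc)
  rw [eventually_nhdsWithin_iff] at hsl
  obtain ⟨K, V, hV, hLip⟩ := hg.locallyLipschitzOn hU ht
  rw [hU.nhdsWithin_eq ht] at hV
  obtain ⟨ε, hε, hball⟩ := Metric.mem_nhds_iff.1 (inter_mem (inter_mem hsl hV) (hU.mem_nhds ht))
  have hLB : LipschitzOnWith K g (Metric.ball t ε) := hLip.mono fun x hx => (hball hx).1.2
  have hae := hLB.ae_differentiableWithinAt_of_mem_real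
  have hdense := Measure.dense_of_ae hae
  obtain ⟨a, ha, had⟩ := hdense.exists_between (show t - ε < t by linarith)
  obtain ⟨b, hb, hbd⟩ := hdense.exists_between (show t < t + ε by linarith)
  have haB : a ∈ Metric.ball t ε := by
    rw [Real.ball_eq_Ioo]; exact ⟨had.1, by linarith [had.2]⟩
  have hbB : b ∈ Metric.ball t ε := by
    rw [Real.ball_eq_Ioo]; exact ⟨by linarith [hbd.1], hbd.2⟩
  have da : DifferentiableAt ℝ g a := (ha haB).differentiableAt (Metric.isOpen_ball.mem_nhds haB)
  have db : DifferentiableAt ℝ g b := (hb hbB).differentiableAt (Metric.isOpen_ball.mem_nhds hbB)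
  have hab : a < b := had.2.trans hbd.1
  have h1 := hg.slope_le_deriv (hball haB).2 (hball hbB).2 hab da
  have h2 := hg.deriv_le_slope (hball haB).2 (hball hbB).2 hab db
  have s1 := (hball haB).1.1 had.2.ne
  have s2 := (hball hbB).1.1 hbd.1.ne'
  rw [slope_def_field] at s1 s2
  have r1 : deriv g a - deriv g t < 0 := by
    by_contra! hh
    have : (deriv g a - deriv g t) / (a - t) ≤ 0 :=
      div_nonpos_of_nonneg_of_nonpos hh (by linarith [had.2])
    linarith
  have r2 : 0 < deriv g b - deriv g t := by
    by_contra! hh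
    have : (deriv g b - deriv g t) / (b - t) ≤ 0 :=
      div_nonpos_of_nonpos_of_nonneg hh (by linarith [hbd.1])
    linarith
  linarith

lemma concave_exp_log {U : Set ℝ} (hU : IsOpen U) (hUc : Convex ℝ U) {F F1 F2 : ℝ → ℝ} (β : ℝ)
    (hF : ∀ t ∈ U, 0 < F t) (h1 : ∀ t ∈ U, HasDerivAt F (F1 t) t)
    (h2 : ∀ t ∈ U, HasDerivAt F1 (F2 t) t)
    (h3 : ∀ t ∈ U, β ^ 2 * F1 t ^ 2 + β * (F2 t * F t) - β * F1 t ^ 2 ≤ 0) :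
    ConcaveOn ℝ U (fun t => Real.exp (β * Real.log (F t))) := by
  have d1 : ∀ t ∈ U, HasDerivAt (fun t => Real.exp (β * Real.log (F t)))
      (Real.exp (β * Real.log (F t)) * (β * (F1 t / F t))) t := fun t ht =>
    (((h1 t ht).log (hF t ht).ne').const_mul β).exp
  have d2 : ∀ t ∈ U, HasDerivAt (fun t => Real.exp (β * Real.log (F t)) * (β * (F1 t / F t)))
      (Real.exp (β * Real.log (F t)) *
        ((β ^ 2 * F1 t ^ 2 + β * (F2 t * F t) - β * F1 t ^ 2) / F t ^ 2)) t := by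
    intro t ht
    have hp := hF t ht
    have := (d1 t ht).mul (((h2 t ht).fun_div (h1 t ht) hp.ne').const_mul β)
    refine this.congr_deriv ?_
    field_simp
    ring
  refine concaveOn_of_hasDerivWithinAt2_nonpos hUc
    (fun t ht => (d1 t ht).continuousAt.continuousWithinAt)
    (f' := fun t => Real.exp (β * Real.log (F t)) * (β * (F1 t / F t)))
    (f'' := fun t => Real.exp (β * Real.log (F t)) *
        ((β ^ 2 * F1 t ^ 2 + β * (F2 t * F t) - β * F1 t ^ 2) / F t ^ 2)) ?_ ?_ ?_
  · intro t ht
    exact (d1 t (interior_subset ht)).hasDerivWithinAt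
  · intro t ht
    exact (d2 t (interior_subset ht)).hasDerivWithinAt
  · intro t ht
    have := h3 t (interior_subset ht)
    have hp := hF t (interior_subset ht)
    exact mul_nonpos_of_nonneg_of_nonpos (Real.exp_pos _).le
      (div_nonpos_of_nonpos_of_nonneg this (by positivity))

lemma heatP_eq (f : ℝ → ℝ) : heatP f = mom f 0 := by
  ext t x; exact (mom_zero f t x).symm

lemma isOpen_dom (f : ℝ → ℝ) (α : ℝ) : IsOpen {t : ℝ | 0 < t ∧ ltTalpha f α t} := by
  rw [isOpen_iff_mem_nhds]
  rintro t ⟨ht, s, hts, hs⟩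
  filter_upwards [Ioo_mem_nhds ht hts] with u hu
  exact ⟨hu.1, s, hu.2, hs⟩

lemma convex_dom (f : ℝ → ℝ) (α : ℝ) : Convex ℝ {t : ℝ | 0 < t ∧ ltTalpha f α t} := by
  refine Set.OrdConnected.convex ⟨?_⟩
  rintro a ⟨ha, -⟩ b ⟨-, s, hbs, hs⟩ c ⟨hac, hcb⟩
  exact ⟨ha.trans_le hac, s, hcb.trans_lt hbs, hs⟩

lemma concave_ne_one {f : ℝ → ℝ} (hf0 : ∀ x, 0 ≤ f x) (hf1 : (∫ x : ℝ, f x) = 1)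
    {α : ℝ} (hα : 0 < α) (hαu : α ≤ 3 / 2 + Real.sqrt 2) (hne : α ≠ 1) :
    ConcaveOn ℝ {t : ℝ | 0 < t ∧ ltTalpha f α t} (fun t => Real.exp (renyiEnt f α t)) := by
  have e : (fun t => Real.exp (renyiEnt f α t)) =
      fun t => Real.exp ((1 - α)⁻¹ * Real.log (∫ x : ℝ, mom f 0 t x ^ α)) := by
    ext t
    rw [renyiEnt, if_neg hne, heatP_eq]
  rw [e]
  have hfin : ∀ t ∈ {t : ℝ | 0 < t ∧ ltTalpha f α t}, 0 < t ∧ ∃ s, t < s ∧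
      Integrable (fun x => mom f 0 s x ^ α) := by
    rintro t ⟨ht, s, hts, hs0, hs⟩
    rw [renyiFinite, if_neg hne, heatP_eq] at hs
    exact ⟨ht, s, hts, hs.1⟩
  refine concave_exp_log (isOpen_dom f α) (convex_dom f α) (F := fun t => ∫ x, mom f 0 t x ^ α)
    (F1 := fun t => ∫ x, mom f 0 t x ^ α * (α / 2 * q2 f t x))
    (F2 := fun t => ∫ x, mom f 0 t x ^ α * (α / 4 * ((α - 1) * q2 f t x ^ 2 + q4 f t x)))
    (1 - α)⁻¹ ?_ ?_ ?_ ?_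
  · intro t ht
    obtain ⟨ht0, s, hts, hs⟩ := hfin t ht
    exact (main_ineq hf0 hf1 hα hαu ht0 hts hs).1
  · intro t ht
    obtain ⟨ht0, s, hts, hs⟩ := hfin t ht
    exact dF hf0 hf1 hα ht0 hts hs
  · intro t ht
    obtain ⟨ht0, s, hts, hs⟩ := hfin t ht
    exact dF1 hf0 hf1 hα ht0 hts hs
  · intro t ht
    obtain ⟨ht0, s, hts, hs⟩ := hfin t ht
    obtain ⟨hF, m, J, e1, e2, e3⟩ := main_ineq hf0 hf1 hα hαu ht0 hts hs
    simp only [e1, e2]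
    have h1α : 1 - α ≠ 0 := sub_ne_zero.2 hne.symm
    set F := ∫ x, mom f 0 t x ^ α
    have : (1 - α)⁻¹ ^ 2 * (α / 2 * (1 - α) * m) ^ 2 + (1 - α)⁻¹ * (α * (α - 1) / 4 * J * F)
        - (1 - α)⁻¹ * (α / 2 * (1 - α) * m) ^ 2 = α / 4 * (α ^ 2 * m ^ 2 - F * J) := by
      field_simp
      ring
    rw [this]
    exact mul_nonpos_of_nonneg_of_nonpos (by positivity) (by linarith)

/-! ### The Shannon case as a limit -/

lemma gK_gauss {t : ℝ} (ht : 0 < t) :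
    gK t = ProbabilityTheory.gaussianPDFReal 0 ⟨t, ht.le⟩ := by
  ext z
  simp [gK, ProbabilityTheory.gaussianPDFReal]
  rfl

lemma mom_conv (f : ℝ → ℝ) (t : ℝ) :
    mom f 0 t = MeasureTheory.convolution f (gK t) (ContinuousLinearMap.mul ℝ ℝ) volume := by
  ext x
  simp [mom, MeasureTheory.convolution]

lemma p_int {f : ℝ → ℝ} (hf1 : (∫ x : ℝ, f x) = 1) {t : ℝ} (ht : 0 < t) :
    Integrable (mom f 0 t) ∧ ∫ x, mom f 0 t x = 1 := by
  have hfi := integrable_of_int_one hf1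
  have hg : Integrable (gK t) := by
    rw [gK_gauss ht]; exact ProbabilityTheory.integrable_gaussianPDFReal _ _
  have hg1 : ∫ z, gK t z = 1 := by
    rw [gK_gauss ht]
    exact ProbabilityTheory.integral_gaussianPDFReal_eq_one _ (by
      intro h; exact ht.ne' (congrArg NNReal.toReal h))
  rw [mom_conv]
  refine ⟨hfi.integrable_convolution _ hg, ?_⟩
  rw [integral_convolution _ hfi hg, hf1, hg1]
  simp

lemma p_le {f : ℝ → ℝ} (hf0 : ∀ x, 0 ≤ f x) (hf1 : (∫ x : ℝ, f x) = 1) {t : ℝ} (ht : 0 < t)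
    (x : ℝ) : mom f 0 t x ≤ (Real.sqrt (2 * Real.pi * t))⁻¹ := by
  have hfi := integrable_of_int_one hf1
  have : (Real.sqrt (2 * Real.pi * t))⁻¹ = ∫ y, f y * (Real.sqrt (2 * Real.pi * t))⁻¹ := by
    rw [integral_mul_const, hf1, one_mul]
  rw [this]
  refine integral_mono (mom_integrable hfi 0 ht x) (hfi.mul_const _) fun y => ?_
  simp only [pow_zero, one_mul]
  exact mul_le_mul_of_nonneg_left (gK_le ht _) (hf0 y)

lemma p_int_rpow {f : ℝ → ℝ} (hf0 : ∀ x, 0 ≤ f x) (hf1 : (∫ x : ℝ, f x) = 1) {t : ℝ} (ht : 0 < t)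
    {a : ℝ} (ha : 1 ≤ a) : Integrable (fun x => mom f 0 t x ^ a) := by
  refine ((p_int hf1 ht).1.const_mul (((Real.sqrt (2 * Real.pi * t))⁻¹) ^ (a - 1))).mono'
    (pa_cont hf0 hf1 ht a).aestronglyMeasurable (Eventually.of_forall fun x => ?_)
  have hp := mom_pos hf0 hf1 ht x
  rw [Real.norm_of_nonneg (by positivity)]
  calc mom f 0 t x ^ a = mom f 0 t x ^ (a - 1) * mom f 0 t x := by
        rw [Real.rpow_sub_one hp.ne']; field_simp
    _ ≤ _ := by
        gcongr
        · exact p_le hf0 hf1 ht x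

lemma ltT_of_gt_one {f : ℝ → ℝ} (hf0 : ∀ x, 0 ≤ f x) (hf1 : (∫ x : ℝ, f x) = 1) {t : ℝ} (ht : 0 < t)
    {a : ℝ} (ha : 1 < a) : ltTalpha f a t := by
  refine ⟨t + 1, by linarith, by linarith, ?_⟩
  have h1 : 0 < t + 1 := by linarith
  rw [renyiFinite, if_neg ha.ne', heatP_eq]
  have I0 := p_int_rpow hf0 hf1 h1 ha.le
  refine ⟨I0, ?_⟩
  have hp : ∀ x, 0 < mom f 0 (t + 1) x ^ a :=
    fun x => Real.rpow_pos_of_pos (mom_pos hf0 hf1 h1 x) a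
  rw [integral_pos_iff_support_of_nonneg (fun x => (hp x).le) I0]
  have : Function.support (fun x => mom f 0 (t + 1) x ^ a) = Set.univ := by
    ext x; simp [(hp x).ne']
  rw [this]; simp

lemma xlogx_bound {a b : ℝ} (ha : 0 < a) (hab : a ≤ b) : |a * Real.log a| ≤ |b * Real.log b| + b := by
  have hb : 0 < b := ha.trans_le hab
  have h1 : Real.log (b / a) ≤ b / a - 1 := Real.log_le_sub_one_of_pos (by positivity)
  have h0 : 0 ≤ Real.log (b / a) := Real.log_nonneg ((one_le_div ha).2 hab)
  have h2 : Real.log (b / a) = Real.log b - Real.log a := Real.log_div hb.ne' ha.ne'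
  have h3 : a * Real.log a = a * Real.log b - a * Real.log (b / a) := by rw [h2]; ring
  rw [h3]
  refine (abs_sub _ _).trans (add_le_add ?_ ?_)
  · rw [abs_mul, abs_mul, abs_of_pos ha, abs_of_pos hb]; gcongr
  · rw [abs_of_nonneg (by positivity)]
    have := mul_le_mul_of_nonneg_left h1 ha.le
    have e : a * (b / a - 1) = b - a := by field_simp
    linarith

lemma plogp_int {f : ℝ → ℝ} (hf0 : ∀ x, 0 ≤ f x) (hf1 : (∫ x : ℝ, f x) = 1) {t s : ℝ} (ht : 0 < t)
    (hts : t < s) (hs : Integrable (fun x => mom f 0 s x * Real.log (mom f 0 s x))) :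
    Integrable (fun x => mom f 0 t x * Real.log (mom f 0 t x)) := by
  have hs0 := ht.trans hts
  have hfi := integrable_of_int_one hf1
  obtain ⟨C, hC, h⟩ := p_mono hf0 hf1 (half_pos ht) (show t / 2 < t by linarith) hts
  have hI := (p_int hf1 hs0).1
  have J : Integrable (fun x => |(C * mom f 0 s x) * Real.log (C * mom f 0 s x)|
      + C * mom f 0 s x) := by
    have : Integrable (fun x => (C * mom f 0 s x) * Real.log (C * mom f 0 s x)) := by
      refine ((hI.const_mul (C * Real.log C)).add (hs.const_mul C)).congr
        (Eventually.of_forall fun x => ?_)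
      simp only [Pi.add_apply]
      rw [Real.log_mul hC.ne' (mom_pos hf0 hf1 hs0 x).ne']
      ring
    exact this.abs.add (hI.const_mul C)
  have hc := mom_cont hfi 0 ht
  refine J.mono' (Continuous.aestronglyMeasurable
    (hc.mul (hc.log fun x => (mom_pos hf0 hf1 ht x).ne'))) (Eventually.of_forall fun x => ?_)
  exact xlogx_bound (mom_pos hf0 hf1 ht x) (h t (by linarith) le_rfl x)

lemma tendsto_renyi {p : ℝ → ℝ} (hp : ∀ x, 0 < p x) (hc : Continuous p) (hi : Integrable p)
    (h1 : ∫ x, p x = 1) (hr : ∀ a : ℝ, 1 ≤ a → Integrable (fun x => p x ^ a))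
    (hl : Integrable (fun x => p x * Real.log (p x))) :
    Tendsto (fun a : ℝ => (1 - a)⁻¹ * Real.log (∫ x, p x ^ a)) (nhdsWithin 1 (Set.Ioi 1))
      (nhds (-∫ x, p x * Real.log (p x))) := by
  have hd : HasDerivWithinAt (fun a : ℝ => ∫ x, p x ^ a) (∫ x, p x * Real.log (p x))
      (Set.Ioi 1) 1 := by
    rw [hasDerivWithinAt_iff_tendsto_slope' (by simp)]
    have key : Tendsto (fun a : ℝ => ∫ x, (a - 1)⁻¹ * (p x ^ a - p x)) (nhdsWithin 1 (Set.Ioi 1))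
        (nhds (∫ x, p x * Real.log (p x))) := by
      refine tendsto_integral_filter_of_dominated_convergence
        (fun x => |p x * Real.log (p x)| + p x ^ (2 : ℝ) + p x) ?_ ?_
        ((hl.abs.add (hr 2 (by norm_num))).add hi) ?_
      · refine Eventually.of_forall fun a => Continuous.aestronglyMeasurable ?_
        have := hc.rpow_const (p := a) fun x => Or.inl (hp x).ne'
        fun_prop
      · have : Set.Ioc (1 : ℝ) 2 ∈ nhdsWithin (1 : ℝ) (Set.Ioi 1) := Ioc_mem_nhdsGT (by norm_num)
        filter_upwards [this] with a ha
        refine Eventually.of_forall fun x => ?_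
        have hx := hp x
        have hd0 : 0 < a - 1 := by linarith [ha.1]
        have e1 : p x ^ a = p x * p x ^ (a - 1) := by
          rw [Real.rpow_sub_one hx.ne']; field_simp
        have l1 : 1 + (a - 1) * Real.log (p x) ≤ p x ^ (a - 1) := by
          rw [Real.rpow_def_of_pos hx]
          have := Real.add_one_le_exp (Real.log (p x) * (a - 1))
          linarith
        have l2 : p x ^ (a - 1) ≤ 1 + (a - 1) * (p x - 1) := by
          have := rpow_one_add_le_one_add_mul_self (s := p x - 1) (by linarith) hd0.le
            (by linarith [ha.2])
          simpa using this
        have u1 : p x * Real.log (p x) ≤ (a - 1)⁻¹ * (p x ^ a - p x) := by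
          rw [e1, inv_mul_eq_div, le_div_iff₀ hd0]
          nlinarith
        have u2 : (a - 1)⁻¹ * (p x ^ a - p x) ≤ p x * (p x - 1) := by
          rw [e1, inv_mul_eq_div, div_le_iff₀ hd0]
          nlinarith
        rw [Real.norm_eq_abs, abs_le, Real.rpow_two]
        have v1 := neg_abs_le (p x * Real.log (p x))
        have v2 := abs_nonneg (p x * Real.log (p x))
        constructor
        · nlinarith [sq_nonneg (p x)]
        · nlinarith
      · refine Eventually.of_forall fun x => ?_
        have hx := hp x
        have h := (Real.hasStrictDerivAt_const_rpow hx 1).hasDerivAt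
        have h2 := (hasDerivAt_iff_tendsto_slope.1 h).mono_left
          (nhdsWithin_mono (1 : ℝ) (show Set.Ioi (1 : ℝ) ⊆ {1}ᶜ from fun y hy => ne_of_gt hy))
        have h3 : Tendsto (slope (fun a : ℝ => p x ^ a) 1) (nhdsWithin 1 (Set.Ioi 1))
            (nhds (p x * Real.log (p x))) := by simpa using h2
        exact h3.congr fun n => by simp [slope]
    refine key.congr' ?_
    filter_upwards [self_mem_nhdsWithin] with a ha
    rw [integral_const_mul, integral_sub (hr a (le_of_lt ha)) hi]
    simp [slope]
  have hF1 : (∫ x, p x ^ (1 : ℝ)) = 1 := by simpa using h1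
  have hlog := hd.log (by rw [hF1]; norm_num)
  rw [hasDerivWithinAt_iff_tendsto_slope' (by simp)] at hlog
  have := hlog.neg
  rw [hF1, div_one] at this
  refine this.congr fun a => ?_
  simp only [slope, vsub_eq_sub, smul_eq_mul, hF1, Real.log_one, sub_zero]
  rw [← neg_sub a 1, inv_neg]
  ring

lemma concave_one {f : ℝ → ℝ} (hf0 : ∀ x, 0 ≤ f x) (hf1 : (∫ x : ℝ, f x) = 1) :
    ConcaveOn ℝ {t : ℝ | 0 < t ∧ ltTalpha f 1 t} (fun t => Real.exp (renyiEnt f 1 t)) := by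
  have hfi := integrable_of_int_one hf1
  have lim : ∀ t ∈ {t : ℝ | 0 < t ∧ ltTalpha f 1 t},
      Tendsto (fun a => Real.exp (renyiEnt f a t)) (nhdsWithin 1 (Set.Ioi 1))
        (nhds (Real.exp (renyiEnt f 1 t))) := by
    rintro t ⟨ht, s, hts, hs0, hs⟩
    refine (Real.continuous_exp.tendsto _).comp ?_
    rw [renyiFinite, if_pos rfl, heatP_eq] at hs
    have hl := plogp_int hf0 hf1 ht hts hs
    have := tendsto_renyi (mom_pos hf0 hf1 ht) (mom_cont hfi 0 ht) (p_int hf1 ht).1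
      (p_int hf1 ht).2 (fun a ha => p_int_rpow hf0 hf1 ht ha) hl
    have e : renyiEnt f 1 t = -∫ x, mom f 0 t x * Real.log (mom f 0 t x) := by
      rw [renyiEnt, if_pos rfl, heatP_eq]
    rw [e]
    refine this.congr' ?_
    filter_upwards [self_mem_nhdsWithin] with a ha
    rw [renyiEnt, if_neg (ne_of_gt ha), heatP_eq]
  refine ⟨convex_dom f 1, ?_⟩
  intro x hx y hy a b ha hb hab
  have hz := convex_dom f 1 hx hy ha hb hab
  refine le_of_tendsto_of_tendsto (((lim x hx).const_smul a).add ((lim y hy).const_smul b))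
    (lim _ hz) ?_
  have : Set.Ioc (1 : ℝ) 2 ∈ nhdsWithin (1 : ℝ) (Set.Ioi 1) := Ioc_mem_nhdsGT (by norm_num)
  filter_upwards [this] with c hc
  have h2 : (1 : ℝ) ≤ Real.sqrt 2 := by
    rw [Real.one_le_sqrt]; norm_num
  have hcon := concave_ne_one hf0 hf1 (α := c) (by linarith [hc.1]) (by linarith [hc.2])
    (ne_of_gt hc.1)
  exact hcon.2 ⟨hx.1, ltT_of_gt_one hf0 hf1 hx.1 hc.1⟩ ⟨hy.1, ltT_of_gt_one hf0 hf1 hy.1 hc.1⟩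
    ha hb hab

/-- Concavity of the square root of the Rényi entropy power, i.e. of
t ↦ exp(h_α(p(·,t))), along the heat flow, for orders 0 < α ≤ 3/2 + √2. -/
theorem renyi_entropy_power_sqrt_concave
    (f : ℝ → ℝ) (hfm : Measurable f) (hf0 : ∀ x, 0 ≤ f x)
    (hf1 : (∫ x : ℝ, f x) = 1)
    (α : ℝ) (hαl : 0 < α) (hαu : α ≤ 3 / 2 + Real.sqrt 2) :
    ConcaveOn ℝ {t : ℝ | 0 < t ∧ ltTalpha f α t}
      (fun t => Real.exp (renyiEnt f α t))
    ∧ ∀ t : ℝ, 0 < t → ltTalpha f α t →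
      iteratedDeriv 2 (fun s => Real.exp (renyiEnt f α s)) t ≤ 0 := by
  have hcon : ConcaveOn ℝ {t : ℝ | 0 < t ∧ ltTalpha f α t}
      (fun t => Real.exp (renyiEnt f α t)) := by
    rcases eq_or_ne α 1 with rfl | hne
    · exact concave_one hf0 hf1
    · exact concave_ne_one hf0 hf1 hαl hαu hne
  exact ⟨hcon, fun t ht hlt =>
    iteratedDeriv_two_nonpos_of_concaveOn (isOpen_dom f α) hcon ⟨ht, hlt⟩⟩
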